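/- If q ∈ (0,1)⁶, i.e., no coordinate of q equals 0 or 1, then the intersection of O_q with the boundary of the unit cube [0,1]³ equals exactly the six-point set V_q. -/

import Mathlib

open Set Pointwise

/-- The 1-skeleton (union of the 12 edges) of the unit cube `[0,1]³`:
points of the cube having at least two coordinates in `{0,1}`. -/
def cubeSkel : Set (Fin 3 → ℝ) :=
  {x | (∀ i, x i ∈ Icc (0:ℝ) 1) ∧
    ∃ i j : Fin 3, i ≠ j ∧ (x i = 0 ∨ x i = 1) ∧ (x j = 0 ∨ x j = 1)}

/-- The six-point configuration `V_p` on the faces of the cube. -/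
def Vpts (p : Fin 6 → ℝ) : Set (Fin 3 → ℝ) :=
  {![0, p 0, p 1], ![1, p 0, p 1], ![p 2, 0, p 3],
   ![p 2, 1, p 3], ![p 4, p 5, 0], ![p 4, p 5, 1]}

/-- `O_p`, the (closed) convex hull of `V_p`. -/
def Oc (p : Fin 6 → ℝ) : Set (Fin 3 → ℝ) := convexHull ℝ (Vpts p)

/-- `C(A,B)`: the smallest number of translates of `B` whose union contains `A`
(`⊤` if no finite cover exists). -/
noncomputable def coverNum (A B : Set (Fin 3 → ℝ)) : ℕ∞ :=
  sInf {n : ℕ∞ | ∃ T : Finset (Fin 3 → ℝ), (T.card : ℕ∞) = n ∧ A ⊆ ⋃ t ∈ T, (t +ᵥ B)}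

/-- If a linear functional attains its minimum over `s` only at `v`, then it attains its minimum
over the convex hull of `s` only at `v`. -/
theorem eq_or_lt_of_mem_convexHull {E : Type*} [AddCommGroup E] [Module ℝ E] (f : E →ₗ[ℝ] ℝ)
    {s : Set E} {v x : E} (hs : ∀ y ∈ s, y = v ∨ f v < f y) (hx : x ∈ convexHull ℝ s) :
    x = v ∨ f v < f x := by
  refine convexHull_min (t := {y | y = v ∨ f v < f y}) hs ?_ hx
  rw [convex_iff_forall_pos]
  intro y hy z hz a b ha hb hab
  obtain rfl : b = 1 - a := by linarith
  simp only [mem_ofPred_eq, map_add, map_smul, smul_eq_mul] at hy hz ⊢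
  rcases hy with rfl | hy <;> rcases hz with rfl | hz
  · exact .inl (by rw [← add_smul, hab, one_smul])
  all_goals exact .inr (by nlinarith)

theorem Vpts_subset_Oc (q : Fin 6 → ℝ) : Vpts q ⊆ Oc q := subset_convexHull ℝ _

theorem eq_of_mem_Oc_of_apply_eq_zero {q : Fin 6 → ℝ} {v x : Fin 3 → ℝ} (i : Fin 3)
    (hs : ∀ y ∈ Vpts q, y = v ∨ 0 < y i) (hv : v i = 0) (hx : x ∈ Oc q) (hxi : x i = 0) :
    x = v := by
  have := eq_or_lt_of_mem_convexHull (LinearMap.proj i : (Fin 3 → ℝ) →ₗ[ℝ] ℝ) (v := v)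
    (s := Vpts q) (by simpa [hv] using hs) hx
  simpa [hv, hxi] using this

theorem eq_of_mem_Oc_of_apply_eq_one {q : Fin 6 → ℝ} {v x : Fin 3 → ℝ} (i : Fin 3)
    (hs : ∀ y ∈ Vpts q, y = v ∨ y i < 1) (hv : v i = 1) (hx : x ∈ Oc q) (hxi : x i = 1) :
    x = v := by
  have := eq_or_lt_of_mem_convexHull (-LinearMap.proj i : (Fin 3 → ℝ) →ₗ[ℝ] ℝ) (v := v)
    (s := Vpts q) (by simpa [hv] using hs) hx
  simpa [hv, hxi] using this

theorem Oc_inter_boundary_eq_Vpts (q : Fin 6 → ℝ) (hq : ∀ i, q i ∈ Ioo (0:ℝ) 1) :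
    Oc q ∩ {x : Fin 3 → ℝ | (∀ i, x i ∈ Icc (0:ℝ) 1) ∧ ∃ i, x i = 0 ∨ x i = 1} =
      Vpts q := by
  have h0 i : 0 < q i := (hq i).1
  have h1 i : q i < 1 := (hq i).2
  have h0' i : 0 ≤ q i := (h0 i).le
  have h1' i : q i ≤ 1 := (h1 i).le
  refine Subset.antisymm ?_ fun x hx ↦ ⟨Vpts_subset_Oc q hx, ?_⟩
  · rintro x ⟨hx, -, i, hi⟩
    fin_cases i <;> rcases hi with hi | hi
    · rw [eq_of_mem_Oc_of_apply_eq_zero (v := ![0, q 0, q 1]) 0 (by simp [Vpts, h0]) rfl hx hi]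
      simp [Vpts]
    · rw [eq_of_mem_Oc_of_apply_eq_one (v := ![1, q 0, q 1]) 0 (by simp [Vpts, h1]) rfl hx hi]
      simp [Vpts]
    · rw [eq_of_mem_Oc_of_apply_eq_zero (v := ![q 2, 0, q 3]) 1 (by simp [Vpts, h0]) rfl hx hi]
      simp [Vpts]
    · rw [eq_of_mem_Oc_of_apply_eq_one (v := ![q 2, 1, q 3]) 1 (by simp [Vpts, h1]) rfl hx hi]
      simp [Vpts]
    · rw [eq_of_mem_Oc_of_apply_eq_zero (v := ![q 4, q 5, 0]) 2 (by simp [Vpts, h0]) rfl hx hi]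
      simp [Vpts]
    · rw [eq_of_mem_Oc_of_apply_eq_one (v := ![q 4, q 5, 1]) 2 (by simp [Vpts, h1]) rfl hx hi]
      simp [Vpts]
  · rcases hx with rfl | rfl | rfl | rfl | rfl | rfl <;>
      simp [Fin.forall_fin_succ, Fin.exists_fin_succ, h0', h1']
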